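/- Let M : ℕ × ℕ → ℝ induce a bounded operator on ℓ² which is elliptic with constant C_ell > 0, fix a block structure on ℕ, assume M is block-banded with bandwidth b₀, and let M = LU be its normalized block-LU factorization (L block-lower triangular with unit diagonal blocks, U block-upper triangular, both bounded with bounded inverses) with D the block diagonal of U. Assume additionally M ∈ B(d,b₀) for a metric d on ℕ. Then there exist ε₀ > 0 and K > 0 such that for every 0 < ε ≤ ε₀ there exist b ∈ ℕ, a block-upper triangular matrix V ∈ B(d,b) which is also block-banded with bandwidth b, satisfying ‖U⁻¹ − V‖₂ ≤ ε and invertible on ℓ² with ‖V‖₂ + ‖V⁻¹‖₂ ≤ K, and a block-diagonal matrix D_ε ∈ B(d,b) inducing a bounded elliptic operator on ℓ² with ‖D − D_ε‖₂ ≤ ε. -/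

import Mathlib

abbrev Mat := ℕ → ℕ → ℝ

noncomputable def mulVec (M : Mat) (x : ℕ → ℝ) : ℕ → ℝ := fun i => ∑' j, M i j * x j

def Memℓ2 (x : ℕ → ℝ) : Prop := Summable fun i => x i ^ 2

noncomputable def l2norm (x : ℕ → ℝ) : ℝ := Real.sqrt (∑' i, x i ^ 2)

def BoundedWith (M : Mat) (K : ℝ) : Prop :=
  ∀ x : ℕ → ℝ, Memℓ2 x →
    (∀ i, Summable fun j => |M i j * x j|) ∧ Memℓ2 (mulVec M x) ∧
      l2norm (mulVec M x) ≤ K * l2norm x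

def IsBoundedOp (M : Mat) : Prop := ∃ K : ℝ, 0 ≤ K ∧ BoundedWith M K

def Elliptic (M : Mat) (c : ℝ) : Prop :=
  ∀ x : ℕ → ℝ, Memℓ2 x → c * (∑' i, x i ^ 2) ≤ ∑' i, mulVec M x i * x i

def IsMetric (d : ℕ → ℕ → ℝ) : Prop :=
  (∀ i j, 0 ≤ d i j) ∧ (∀ i j, d i j = 0 ↔ i = j) ∧ (∀ i j, d i j = d j i) ∧
    ∀ i j k, d i k ≤ d i j + d j k

def Banded (d : ℕ → ℕ → ℝ) (b : ℝ) (M : Mat) : Prop := ∀ i j, b < d i j → M i j = 0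

def IsBlockStructure (n : ℕ → ℕ) : Prop := StrictMono n ∧ n 0 = 0

def InBlock (n : ℕ → ℕ) (i p : ℕ) : Prop := n i ≤ p ∧ p < n (i + 1)

def BlockBanded (n : ℕ → ℕ) (b : ℕ) (M : Mat) : Prop :=
  ∀ i j p q, InBlock n i p → InBlock n j q → (b : ℤ) < |(i : ℤ) - (j : ℤ)| → M p q = 0

def BlockDiag (n : ℕ → ℕ) (M : Mat) : Prop :=
  ∀ i j p q, InBlock n i p → InBlock n j q → i ≠ j → M p q = 0

def BlockLower (n : ℕ → ℕ) (M : Mat) : Prop :=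
  ∀ i j p q, InBlock n i p → InBlock n j q → i < j → M p q = 0

def BlockUpper (n : ℕ → ℕ) (M : Mat) : Prop :=
  ∀ i j p q, InBlock n i p → InBlock n j q → j < i → M p q = 0

def idMat : Mat := fun p q => if p = q then 1 else 0

def UnitDiagBlocks (n : ℕ → ℕ) (M : Mat) : Prop :=
  ∀ i p q, InBlock n i p → InBlock n i q → M p q = idMat p q

def matSub (A B : Mat) : Mat := fun p q => A p q - B p q

def IsInverseOn (M N : Mat) : Prop :=
  ∀ x : ℕ → ℝ, Memℓ2 x →
    Memℓ2 (mulVec M x) ∧ Memℓ2 (mulVec N x) ∧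
      mulVec N (mulVec M x) = x ∧ mulVec M (mulVec N x) = x

open Classical in
noncomputable def blockDiagOf (n : ℕ → ℕ) (M : Mat) : Mat :=
  fun p q => if ∃ i, InBlock n i p ∧ InBlock n i q then M p q else 0

open scoped InnerProductSpace

/-- The Hilbert space of square-summable sequences. -/
abbrev HS := lp (fun _ : ℕ => ℝ) 2

noncomputable def ee (q : ℕ) : HS := lp.single 2 q (1 : ℝ)

lemma ee_apply (q p : ℕ) : ee q p = if p = q then 1 else 0 := by
  unfold ee
  by_cases h : p = q
  · subst h; simp
  · simp [h]

lemma memlp_iff (x : ℕ → ℝ) : Memℓp (E := fun _ : ℕ => ℝ) x 2 ↔ Memℓ2 x := by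
  rw [memℓp_gen_iff (by norm_num)]
  unfold Memℓ2
  simp

lemma hs_mem (x : HS) : Memℓ2 x := (memlp_iff x).1 x.2

lemma hs_hasSum (x : HS) : HasSum (fun i => x i ^ 2) (‖x‖ ^ 2) := by
  have := lp.hasSum_norm (p := 2) (by norm_num) x
  simpa using this

lemma hs_norm (x : HS) : l2norm x = ‖x‖ := by
  unfold l2norm
  rw [(hs_hasSum x).tsum_eq, Real.sqrt_sq (norm_nonneg _)]

lemma hs_inner (x y : HS) : HasSum (fun i => x i * y i) ⟪x, y⟫_ℝ := by
  have := lp.hasSum_inner (𝕜 := ℝ) x y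
  simpa [mul_comm] using this

/-- coordinate functional -/
noncomputable def coord (p : ℕ) : HS →L[ℝ] ℝ := innerSL ℝ (ee p)

lemma coord_apply (p : ℕ) (x : HS) : coord p x = x p := by
  unfold coord ee
  rw [innerSL_apply_apply, lp.inner_single_left]
  simp

lemma ent_hasSum (T : HS →L[ℝ] HS) (x : HS) (p : ℕ) :
    HasSum (fun q => T (ee q) p * x q) (T x p) := by
  have h := lp.hasSum_single (p := 2) (by norm_num) x
  have h2 := h.mapL ((coord p).comp T)
  simp only [ContinuousLinearMap.comp_apply, coord_apply] at h2
  convert h2 using 1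
  funext q
  have : lp.single 2 q (x q) = (x q) • ee q := by
    unfold ee
    rw [← lp.single_smul]; simp
  rw [this]
  simp [mul_comm]

lemma op_ext {S T : HS →L[ℝ] HS} (h : ∀ p q, S (ee q) p = T (ee q) p) : S = T := by
  ext x p
  have h1 := ent_hasSum S x p
  have h2 := ent_hasSum T x p
  simp only [h] at h1
  exact h1.unique h2

lemma op_zero {T : HS →L[ℝ] HS} {x : HS} {p : ℕ} (h : ∀ r, T (ee r) p = 0 ∨ x r = 0) :
    T x p = 0 := by
  have h1 := ent_hasSum T x p
  have : (fun q => T (ee q) p * x q) = fun _ => 0 := by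
    funext q
    rcases h q with h | h <;> simp [h]
  rw [this] at h1
  exact h1.unique hasSum_zero

lemma mk_op (f : HS →ₗ[ℝ] (ℕ → ℝ)) (κ : ℝ) (hκ : 0 ≤ κ)
    (h : ∀ x, ∀ s : Finset ℕ, ∑ i ∈ s, f x i ^ 2 ≤ (κ * ‖x‖) ^ 2) :
    ∃ T : HS →L[ℝ] HS, ‖T‖ ≤ κ ∧ ∀ x i, T x i = f x i := by
  have hm : ∀ x, Memℓp (E := fun _ : ℕ => ℝ) (f x) 2 := fun x =>
    memℓp_gen' (C := (κ * ‖x‖) ^ 2) (fun s => by simpa using h x s)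
  let g : HS →ₗ[ℝ] HS :=
    { toFun := fun x => ⟨f x, hm x⟩
      map_add' := fun x y => by ext i; simp only [map_add]; rfl
      map_smul' := fun c x => by ext i; simp only [map_smul]; rfl }
  refine ⟨g.mkContinuous κ ?_, LinearMap.mkContinuous_norm_le _ hκ _, fun x i => rfl⟩
  intro x
  refine lp.norm_le_of_forall_sum_le (by norm_num) (by positivity) ?_
  intro s
  simpa [g] using h x s

lemma op_of_bounded {M : Mat} {K : ℝ} (hK : 0 ≤ K) (h : BoundedWith M K) :
    ∃ T : HS →L[ℝ] HS, ‖T‖ ≤ K ∧ (∀ x : HS, ∀ i, T x i = mulVec M x i) ∧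
      ∀ p q, T (ee q) p = M p q := by
  have hs : ∀ (x : HS) i, Summable fun j => M i j * x j := fun x i =>
    ((h x (hs_mem x)).1 i).of_abs
  obtain ⟨T, hT, hT2⟩ := mk_op
    { toFun := fun x => mulVec M x
      map_add' := fun x y => by
        funext i
        simp only [mulVec, lp.coeFn_add, Pi.add_apply, mul_add]
        exact (hs x i).tsum_add (hs y i)
      map_smul' := fun c x => by
        funext i
        simp only [mulVec, lp.coeFn_smul, Pi.smul_apply, smul_eq_mul, RingHom.id_apply]
        rw [← tsum_mul_left]
        congr 1; funext j; ring } K hK (by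
      intro x s
      obtain ⟨-, h2, h3⟩ := h x (hs_mem x)
      rw [hs_norm] at h3
      have h4 : ∑ i ∈ s, mulVec M x i ^ 2 ≤ ∑' i, mulVec M x i ^ 2 :=
        h2.sum_le_tsum s (fun i _ => sq_nonneg _)
      refine h4.trans ?_
      unfold l2norm at h3
      exact (Real.sqrt_le_left (by positivity)).1 h3)
  refine ⟨T, hT, hT2, ?_⟩
  intro p q
  rw [hT2]
  simp only [LinearMap.coe_mk, AddHom.coe_mk, mulVec, ee_apply]
  rw [tsum_eq_single q]
  · simp
  · intro b hb; simp [hb]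

lemma mulVec_op {M : Mat} {T : HS →L[ℝ] HS} (h : ∀ p q, T (ee q) p = M p q) (x : HS) :
    mulVec M x = T x := by
  funext i
  have := ent_hasSum T x i
  simp only [h] at this
  exact this.tsum_eq

lemma bounded_of_op {M : Mat} {K : ℝ} {T : HS →L[ℝ] HS} (h : ∀ p q, T (ee q) p = M p q)
    (hT : ‖T‖ ≤ K) : BoundedWith M K := by
  intro x hx
  let y : HS := ⟨x, (memlp_iff x).2 hx⟩
  change (∀ i, Summable fun j => |M i j * y j|) ∧ Memℓ2 (mulVec M y) ∧
      l2norm (mulVec M y) ≤ K * l2norm y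
  rw [mulVec_op h, hs_norm, hs_norm]
  refine ⟨fun i => ?_, hs_mem _, T.le_of_opNorm_le hT y⟩
  have := ent_hasSum T y i
  simp only [h] at this
  exact this.summable.abs

lemma elliptic_iff {M : Mat} {c : ℝ} {T : HS →L[ℝ] HS} (h : ∀ p q, T (ee q) p = M p q) :
    Elliptic M c ↔ ∀ x : HS, c * ‖x‖ ^ 2 ≤ ⟪T x, x⟫_ℝ := by
  constructor
  · intro hM x
    have := hM x (hs_mem x)
    rwa [(hs_hasSum x).tsum_eq, mulVec_op h, (hs_inner (T x) x).tsum_eq] at this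
  · intro hT x hx
    let y : HS := ⟨x, (memlp_iff x).2 hx⟩
    change c * (∑' i, y i ^ 2) ≤ ∑' i, mulVec M y i * y i
    rw [(hs_hasSum y).tsum_eq, mulVec_op h, (hs_inner (T y) y).tsum_eq]
    exact hT y

lemma inverse_of_op {M N : Mat} {S T : HS →L[ℝ] HS} (hS : ∀ p q, S (ee q) p = M p q)
    (hT : ∀ p q, T (ee q) p = N p q) (h1 : S * T = 1) (h2 : T * S = 1) : IsInverseOn M N := by
  intro x hx
  let y : HS := ⟨x, (memlp_iff x).2 hx⟩
  change Memℓ2 (mulVec M y) ∧ Memℓ2 (mulVec N y) ∧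
      mulVec N (mulVec M y) = y ∧ mulVec M (mulVec N y) = y
  rw [mulVec_op hS, mulVec_op hT, mulVec_op hS, mulVec_op hT]
  refine ⟨hs_mem _, hs_mem _, ?_, ?_⟩
  · rw [← mul_apply_eq_comp, h2]; rfl
  · rw [← mul_apply_eq_comp, h1]; rfl

lemma op_of_inverse {M N : Mat} {S T : HS →L[ℝ] HS} (hS : ∀ p q, S (ee q) p = M p q)
    (hT : ∀ p q, T (ee q) p = N p q) (h : IsInverseOn M N) : S * T = 1 ∧ T * S = 1 := by
  constructor
  · ext x p
    obtain ⟨-, -, -, h2⟩ := h x (hs_mem x)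
    rw [mulVec_op hT, mulVec_op hS] at h2
    exact congrFun h2 p
  · ext x p
    obtain ⟨-, -, h2, -⟩ := h x (hs_mem x)
    rw [mulVec_op hS, mulVec_op hT] at h2
    exact congrFun h2 p

lemma proj_exists (s : Set ℕ) : ∃ T : HS →L[ℝ] HS, ‖T‖ ≤ 1 ∧ ∀ x i, T x i = s.indicator x i := by
  refine mk_op
    { toFun := fun x => s.indicator x
      map_add' := fun x y => by rw [lp.coeFn_add]; exact Set.indicator_add _ _ _
      map_smul' := fun c x => by
        funext i
        by_cases h : i ∈ s <;> simp [h] } 1 zero_le_one ?_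
  intro x t
  simp only [LinearMap.coe_mk, AddHom.coe_mk, one_mul]
  refine le_trans ?_ (sum_le_hasSum t (fun i _ => sq_nonneg _) (hs_hasSum x))
  refine Finset.sum_le_sum fun i _ => ?_
  by_cases h : i ∈ s
  · simp [h]
  · simp [h, sq_nonneg]

/-- coordinate projection -/
noncomputable def proj (s : Set ℕ) : HS →L[ℝ] HS := (proj_exists s).choose

lemma proj_norm (s : Set ℕ) : ‖proj s‖ ≤ 1 := (proj_exists s).choose_spec.1

lemma proj_apply (s : Set ℕ) (x : HS) (i : ℕ) : proj s x i = s.indicator x i :=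
  (proj_exists s).choose_spec.2 x i

lemma proj_of_mem {s : Set ℕ} {i : ℕ} (h : i ∈ s) (x : HS) : proj s x i = x i := by
  rw [proj_apply, Set.indicator_of_mem h]

lemma proj_of_notMem {s : Set ℕ} {i : ℕ} (h : i ∉ s) (x : HS) : proj s x i = 0 := by
  rw [proj_apply, Set.indicator_of_notMem h]

lemma proj_eq_self {s : Set ℕ} {x : HS} (h : ∀ i, i ∉ s → x i = 0) : proj s x = x := by
  ext i
  by_cases hi : i ∈ s
  · rw [proj_of_mem hi]
  · rw [proj_of_notMem hi, h i hi]

/-- sums over the fibres of the block function -/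
lemma fiber_sq (β : ℕ → ℕ) (x : HS) :
    HasSum (fun k => ‖proj {q | β q = k} x‖ ^ 2) (‖x‖ ^ 2) := by
  have := (hs_hasSum x).tsum_fiberwise β
  have key : (fun k => ‖proj {q | β q = k} x‖ ^ 2) =
      fun c => ∑' b : β ⁻¹' {c}, x b ^ 2 := by
    funext k
    rw [← (hs_hasSum (proj {q | β q = k} x)).tsum_eq]
    have h3 := tsum_subtype (β ⁻¹' {k}) (fun i => x i ^ 2)
    rw [h3]
    congr 1; funext i
    by_cases hi : β i = k
    · rw [proj_of_mem (by exact hi), Set.indicator_of_mem (by exact hi)]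
    · rw [proj_of_notMem (by exact hi), Set.indicator_of_notMem (by exact hi)]; simp
  rw [key]; exact this

lemma fiber_inner (β : ℕ → ℕ) (x y : HS) :
    HasSum (fun k => ⟪proj {q | β q = k} x, proj {q | β q = k} y⟫_ℝ) ⟪x, y⟫_ℝ := by
  have := (hs_inner x y).tsum_fiberwise β
  have key : (fun k => ⟪proj {q | β q = k} x, proj {q | β q = k} y⟫_ℝ) =
      fun c => ∑' b : β ⁻¹' {c}, x b * y b := by
    funext k
    rw [← (hs_inner (proj {q | β q = k} x) _).tsum_eq]
    have h3 := tsum_subtype (β ⁻¹' {k}) (fun i => x i * y i)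
    rw [h3]
    congr 1; funext i
    by_cases hi : β i = k
    · rw [proj_of_mem (by exact hi), proj_of_mem (by exact hi), Set.indicator_of_mem (by exact hi)]
    · rw [proj_of_notMem (by exact hi), Set.indicator_of_notMem (by exact hi)]; simp
  rw [key]; exact this

/-- block offset pieces -/
lemma pinch_exists (β : ℕ → ℕ) (A : ℕ → HS →L[ℝ] HS) (κ : ℝ) (hκ : 0 ≤ κ)
    (hA : ∀ k, ‖A k‖ ≤ κ) (m : ℕ) :
    ∃ T : HS →L[ℝ] HS, ‖T‖ ≤ κ ∧
      ∀ x p, T x p = A (β p + m) (proj {q | β q = β p + m} x) p := by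
  refine mk_op
    { toFun := fun x p => A (β p + m) (proj {q | β q = β p + m} x) p
      map_add' := fun x y => by funext p; simp
      map_smul' := fun c x => by funext p; simp } κ hκ ?_
  intro x s
  simp only [LinearMap.coe_mk, AddHom.coe_mk]
  set y : ℕ → HS := fun i => A (i + m) (proj {q | β q = i + m} x) with hy
  rw [← Finset.sum_fiberwise_of_maps_to (t := s.image β) (g := β)
    (fun i hi => Finset.mem_image_of_mem _ hi)]
  calc _ ≤ ∑ j ∈ s.image β, ‖y j‖ ^ 2 := by
        refine Finset.sum_le_sum fun j _ => ?_
        calc _ = ∑ i ∈ s with β i = j, (y j i) ^ 2 := by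
              refine Finset.sum_congr rfl fun i hi => ?_
              rw [Finset.mem_filter] at hi
              simp only [hy, ← hi.2]
          _ ≤ _ := sum_le_hasSum _ (fun i _ => sq_nonneg _) (hs_hasSum (y j))
    _ ≤ ∑ j ∈ s.image β, κ ^ 2 * ‖proj {q | β q = j + m} x‖ ^ 2 := by
        refine Finset.sum_le_sum fun j _ => ?_
        rw [← mul_pow]
        gcongr
        exact (A _).le_of_opNorm_le (hA _) _
    _ = κ ^ 2 * ∑ k ∈ (s.image β).map (addRightEmbedding m), ‖proj {q | β q = k} x‖ ^ 2 := by
        rw [Finset.sum_map, Finset.mul_sum]; rfl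
    _ ≤ κ ^ 2 * ‖x‖ ^ 2 := by
        gcongr
        exact sum_le_hasSum _ (fun i _ => sq_nonneg _) (fiber_sq β x)
    _ = _ := by ring

/-- operator bandedness with respect to a distance-like function -/
def OpBand (d : ℕ → ℕ → ℝ) (b : ℝ) (T : HS →L[ℝ] HS) : Prop :=
  ∀ p q, b < d p q → T (ee q) p = 0

lemma OpBand.mono {d : ℕ → ℕ → ℝ} {a b : ℝ} {T : HS →L[ℝ] HS} (h : OpBand d a T) (hab : a ≤ b) :
    OpBand d b T := fun p q hpq => h p q (hab.trans_lt hpq)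

lemma OpBand.add {d : ℕ → ℕ → ℝ} {b : ℝ} {S T : HS →L[ℝ] HS} (h : OpBand d b S)
    (h' : OpBand d b T) : OpBand d b (S + T) := fun p q hpq => by
  simp [h p q hpq, h' p q hpq]

lemma OpBand.smul {d : ℕ → ℕ → ℝ} {b : ℝ} {T : HS →L[ℝ] HS} (h : OpBand d b T) (c : ℝ) :
    OpBand d b (c • T) := fun p q hpq => by
  simp [h p q hpq]

lemma OpBand.mul {d : ℕ → ℕ → ℝ} (hd : ∀ i j k, d i k ≤ d i j + d j k) {a b : ℝ}
    {S T : HS →L[ℝ] HS} (h : OpBand d a S) (h' : OpBand d b T) : OpBand d (a + b) (S * T) := by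
  intro p q hpq
  rw [mul_apply_eq_comp]
  refine op_zero fun r => ?_
  by_cases h1 : a < d p r
  · exact Or.inl (h p r h1)
  · refine Or.inr (h' r q ?_)
    have := hd p r q
    linarith

lemma proj_ee (s : Set ℕ) (q : ℕ) : proj s (ee q) = s.indicator (fun q => ee q) q := by
  ext p
  rw [proj_apply]
  by_cases hq : q ∈ s
  · rw [Set.indicator_of_mem hq]
    by_cases hp : p ∈ s
    · rw [Set.indicator_of_mem hp]
    · rw [Set.indicator_of_notMem hp, ee_apply, if_neg]
      rintro rfl; exact hp hq
  · rw [Set.indicator_of_notMem hq]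
    by_cases hp : p ∈ s
    · rw [Set.indicator_of_mem hp, ee_apply, if_neg]
      · rfl
      rintro rfl; exact hq hp
    · rw [Set.indicator_of_notMem hp]; rfl

lemma opBand_proj {d : ℕ → ℕ → ℝ} (hd0 : ∀ i, d i i = 0) (s : Set ℕ) :
    OpBand d 0 (proj s) := by
  intro p q hpq
  have hne : p ≠ q := by
    rintro rfl
    rw [hd0] at hpq
    exact lt_irrefl _ hpq
  rw [proj_apply]
  by_cases hp : p ∈ s
  · rw [Set.indicator_of_mem hp, ee_apply, if_neg hne]
  · rw [Set.indicator_of_notMem hp]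

lemma opBand_one {d : ℕ → ℕ → ℝ} (hd0 : ∀ i, d i i = 0) : OpBand d 0 (1 : HS →L[ℝ] HS) := by
  intro p q hpq
  have hne : p ≠ q := by
    rintro rfl
    rw [hd0] at hpq
    exact lt_irrefl _ hpq
  rw [one_apply_eq_self, ee_apply, if_neg hne]

lemma OpBand.pow {d : ℕ → ℕ → ℝ} (hd0 : ∀ i, d i i = 0) (hd : ∀ i j k, d i k ≤ d i j + d j k)
    {b : ℝ} {T : HS →L[ℝ] HS} (h : OpBand d b T) (n : ℕ) : OpBand d (n * b) (T ^ n) := by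
  induction n with
  | zero => simpa using opBand_one hd0
  | succ n ih =>
    rw [pow_succ]
    refine (OpBand.mul hd ih h).mono (le_of_eq ?_)
    push_cast; ring

lemma contraction (T : HS →L[ℝ] HS) (c : ℝ) (hc : 0 < c)
    (h : ∀ x, c * ‖x‖ ^ 2 ≤ ⟪T x, x⟫_ℝ) : ∃ α : ℝ, 0 < α ∧ ‖1 - α • T‖ < 1 := by
  set K := ‖T‖ + c with hK
  have hT := norm_nonneg T
  have hK0 : 0 < K := by positivity
  have hcK : c ≤ K := by linarith
  refine ⟨c / K ^ 2, by positivity, ?_⟩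
  have hr : 0 ≤ 1 - c ^ 2 / K ^ 2 := by
    rw [sub_nonneg, div_le_one (by positivity)]
    gcongr
  have hlt : Real.sqrt (1 - c ^ 2 / K ^ 2) < 1 := by
    rw [Real.sqrt_lt' one_pos]
    have : 0 < c ^ 2 / K ^ 2 := by positivity
    linarith
  refine lt_of_le_of_lt (ContinuousLinearMap.opNorm_le_bound _ (Real.sqrt_nonneg _) ?_) hlt
  intro x
  refine abs_le_of_sq_le_sq' ?_ (by positivity) |>.2
  rw [mul_pow, Real.sq_sqrt hr]
  have e : (1 - (c / K ^ 2) • T) x = x - (c / K ^ 2) • T x := by simp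
  rw [e, norm_sub_sq_real, inner_smul_right, norm_smul, real_inner_comm, mul_pow,
    Real.norm_eq_abs, sq_abs]
  have h1 := h x
  have h2 : ‖T x‖ ^ 2 ≤ K ^ 2 * ‖x‖ ^ 2 := by
    rw [← mul_pow]
    gcongr
    exact T.le_of_opNorm_le (by linarith) x
  have h3 : c / K ^ 2 * (c * ‖x‖ ^ 2) ≤ c / K ^ 2 * ⟪T x, x⟫_ℝ := by gcongr
  have h4 : (c / K ^ 2) ^ 2 * ‖T x‖ ^ 2 ≤ (c / K ^ 2) ^ 2 * (K ^ 2 * ‖x‖ ^ 2) := by gcongr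
  have e1 : (c / K ^ 2) ^ 2 * (K ^ 2 * ‖x‖ ^ 2) = c ^ 2 / K ^ 2 * ‖x‖ ^ 2 := by
    field_simp
  have e2 : c / K ^ 2 * (c * ‖x‖ ^ 2) = c ^ 2 / K ^ 2 * ‖x‖ ^ 2 := by
    field_simp
  rw [e1] at h4
  rw [e2] at h3
  linarith

/-- block distance -/
def bdist (β : ℕ → ℕ) : ℕ → ℕ → ℝ := fun p q => |(β p : ℝ) - β q|

lemma bdist_self (β : ℕ → ℕ) (i : ℕ) : bdist β i i = 0 := by simp [bdist]

lemma bdist_tri (β : ℕ → ℕ) (i j k : ℕ) : bdist β i k ≤ bdist β i j + bdist β j k :=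
  abs_sub_le _ _ _

def OpUpper (β : ℕ → ℕ) (T : HS →L[ℝ] HS) : Prop := ∀ p q, β q < β p → T (ee q) p = 0

lemma OpUpper.apply {β : ℕ → ℕ} {T : HS →L[ℝ] HS} (h : OpUpper β T) {x : HS} {k : ℕ}
    (hx : ∀ p, k < β p → x p = 0) {p : ℕ} (hp : k < β p) : T x p = 0 := by
  refine op_zero fun r => ?_
  by_cases hr : k < β r
  · exact Or.inr (hx r hr)
  · exact Or.inl (h p r (by omega))

/-- unit block-lower operators are injective on initial blocks -/
lemma lower_inj {β : ℕ → ℕ} {L : HS →L[ℝ] HS}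
    (hL : ∀ p q, β p < β q → L (ee q) p = 0) (hLd : ∀ p q, β p = β q → L (ee q) p = ee q p)
    {k : ℕ} {w : HS} (hw : ∀ p, k < β p → w p = 0) (hLw : ∀ p, β p ≤ k → L w p = 0) :
    w = 0 := by
  have key : ∀ i, ∀ p, β p = i → w p = 0 := by
    intro i
    induction i using Nat.strong_induction_on with
    | _ i ih =>
      intro p hp
      by_cases hk : k < β p
      · exact hw p hk
      have h0 : (L - 1) w p = 0 := by
        refine op_zero fun r => ?_
        rcases lt_trichotomy (β r) i with h | h | h
        · exact Or.inr (ih _ h r rfl)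
        · left
          have := hLd p r (by omega)
          simp [this]
        · left
          have := hL p r (by omega)
          have h3 : ee r p = 0 := by
            rw [ee_apply, if_neg]
            rintro rfl; omega
          simp [this, h3]
      have h1 := hLw p (by omega)
      simp [h1] at h0
      exact h0
  ext p
  exact key _ p rfl

lemma key_column {β : ℕ → ℕ} {M L U Ui : HS →L[ℝ] HS}
    (hL : ∀ p q, β p < β q → L (ee q) p = 0) (hLd : ∀ p q, β p = β q → L (ee q) p = ee q p)
    (hU : OpUpper β U) (hM : M = L * U) (hUi : Ui * U = 1)
    {α : ℝ} (hα : 0 < α) (hB : ‖1 - α • M‖ < 1) (q : ℕ) :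
    Ui (ee q) = α • (∑' n : ℕ, (proj {p | β p ≤ β q} * (1 - α • M)) ^ n) (ee q) ∧
    ∀ p, β q < β p → Ui (ee q) p = 0 := by
  set P := proj {p | β p ≤ β q} with hP
  have hPB : ‖P * (1 - α • M)‖ < 1 := by
    refine (norm_mul_le _ _).trans_lt (lt_of_le_of_lt ?_ hB)
    exact mul_le_of_le_one_left (norm_nonneg _) (proj_norm _)
  have hG := mul_neg_geom_series _ hPB
  set G := ∑' n : ℕ, (P * (1 - α • M)) ^ n with hGdef
  obtain ⟨y, hy⟩ : ∃ y, y = α • G (ee q) := ⟨_, rfl⟩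
  have h1 : y - P (y - α • M y) = α • ee q := by
    have := congrArg (fun T : HS →L[ℝ] HS => α • T (ee q)) hG
    simp only [mul_apply_eq_comp, one_apply_eq_self, sub_apply,
      smul_apply] at this
    rw [← this, hy]
    simp only [map_smul, map_sub, smul_sub]
  have hq0 : ∀ p, β q < β p → ee q p = 0 := by
    intro p hp
    rw [ee_apply, if_neg]
    rintro rfl; omega
  have hysupp : ∀ p, β q < β p → y p = 0 := by
    intro p hp
    have h2 : (y - P (y - α • M y)) p = (α • ee q) p := by rw [h1]
    rw [lp.coeFn_sub, Pi.sub_apply, hP, proj_of_notMem (by simpa using hp), lp.coeFn_smul,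
      Pi.smul_apply, hq0 p hp] at h2
    simpa using h2
  have hPM : ∀ p, β p ≤ β q → M y p = ee q p := by
    intro p hp
    have h2 : (y - P (y - α • M y)) p = (α • ee q) p := by rw [h1]
    rw [lp.coeFn_sub, Pi.sub_apply, hP, proj_of_mem (by simpa using hp), lp.coeFn_smul,
      Pi.smul_apply] at h2
    rw [lp.coeFn_sub, Pi.sub_apply, lp.coeFn_smul, Pi.smul_apply, sub_sub_cancel] at h2
    exact smul_right_injective ℝ hα.ne' h2
  have hUy : U y - ee q = 0 := by
    refine lower_inj hL hLd (k := β q) ?_ ?_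
    · intro p hp
      simp [hU.apply hysupp hp, hq0 p hp]
    · intro p hp
      have h3 := hPM p hp
      rw [hM, mul_apply_eq_comp] at h3
      rw [map_sub, lp.coeFn_sub, Pi.sub_apply, h3, sub_eq_zero]
      rcases hp.lt_or_eq with h | h
      · rw [hL p q h, ee_apply, if_neg]
        rintro rfl; omega
      · rw [hLd p q h]
  have hfin : Ui (ee q) = y := by
    rw [← sub_eq_zero.1 hUy, ← mul_apply_eq_comp, hUi, one_apply_eq_self]
  refine ⟨hfin.trans hy, ?_⟩
  rw [hfin]
  exact hysupp

lemma piece (β : ℕ → ℕ) (B : HS →L[ℝ] HS) (b₀ : ℕ) (hB : OpBand (bdist β) b₀ B) (n : ℕ) :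
    ∃ T : HS →L[ℝ] HS, ‖T‖ ≤ (n * b₀ + 1) * ‖B‖ ^ n ∧
      (∀ p q, T (ee q) p = ((proj {r | β r ≤ β q} * B) ^ n) (ee q) p) ∧ OpUpper β T := by
  have hA : ∀ k, ‖(proj {r | β r ≤ k} * B) ^ n‖ ≤ ‖B‖ ^ n := by
    intro k
    induction n with
    | zero =>
      rw [pow_zero, pow_zero]
      exact ContinuousLinearMap.norm_id_le
    | succ n ih =>
      rw [pow_succ, pow_succ]
      refine (norm_mul_le _ _).trans ?_
      gcongr
      refine (norm_mul_le _ _).trans ?_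
      exact mul_le_of_le_one_left (norm_nonneg _) (proj_norm _)
  choose E hE1 hE2 using pinch_exists β (fun k => (proj {r | β r ≤ k} * B) ^ n) (‖B‖ ^ n)
    (by positivity) hA
  have hband : ∀ k, OpBand (bdist β) (n * b₀) ((proj {r | β r ≤ k} * B) ^ n) := by
    intro k
    have := (OpBand.mul (bdist_tri β) (opBand_proj (bdist_self β) {r | β r ≤ k}) hB)
    rw [zero_add] at this
    exact this.pow (bdist_self β) (bdist_tri β) n
  have hupp : ∀ p q, β q < β p → ((proj {r | β r ≤ β q} * B) ^ n) (ee q) p = 0 := by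
    intro p q hpq
    cases n with
    | zero =>
      rw [pow_zero, one_apply_eq_self, ee_apply, if_neg]
      rintro rfl; omega
    | succ n =>
      rw [pow_succ', mul_assoc, mul_apply_eq_comp, proj_of_notMem]
      simpa using hpq
  have hent : ∀ p q, (∑ m ∈ Finset.range (n * b₀ + 1), E m) (ee q) p =
      ((proj {r | β r ≤ β q} * B) ^ n) (ee q) p := by
    intro p q
    have e1 : (∑ m ∈ Finset.range (n * b₀ + 1), E m) (ee q) p =
        ∑ m ∈ Finset.range (n * b₀ + 1), E m (ee q) p := by
      rw [sum_apply, lp.coeFn_sum, Finset.sum_apply]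
    have e2 : ∀ m, E m (ee q) p = if β q = β p + m then
        ((proj {r | β r ≤ β q} * B) ^ n) (ee q) p else 0 := by
      intro m
      rw [hE2, proj_ee]
      split_ifs with h
      · rw [Set.indicator_of_mem (by exact h), h]
      · rw [Set.indicator_of_notMem (by exact h), map_zero]; rfl
    rw [e1]
    simp only [e2]
    rcases lt_or_ge (β q) (β p) with h | h
    · rw [hupp p q h]; simp
    by_cases h2 : β q - β p < n * b₀ + 1
    · rw [Finset.sum_eq_single (β q - β p)]
      · rw [if_pos (by omega)]
      · intro m _ hm
        rw [if_neg (by omega)]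
      · intro h3
        exact absurd (Finset.mem_range.2 h2) h3
    · rw [hband (β q) p q]
      · simp
      · unfold bdist
        rw [abs_sub_comm, ← Nat.cast_sub h, Nat.abs_cast]
        exact_mod_cast (by omega : n * b₀ < β q - β p)
  refine ⟨∑ m ∈ Finset.range (n * b₀ + 1), E m, ?_, hent, ?_⟩
  · refine (norm_sum_le _ _).trans ?_
    refine (Finset.sum_le_sum fun m _ => hE1 m).trans ?_
    simp
  · intro p q hpq
    rw [hent]
    exact hupp p q hpq

lemma main_V {β : ℕ → ℕ} {M L U Ui : HS →L[ℝ] HS}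
    (hL : ∀ p q, β p < β q → L (ee q) p = 0) (hLd : ∀ p q, β p = β q → L (ee q) p = ee q p)
    (hU : OpUpper β U) (hM : M = L * U) (hUi : Ui * U = 1)
    {c : ℝ} (hc : 0 < c) (hell : ∀ x, c * ‖x‖ ^ 2 ≤ ⟪M x, x⟫_ℝ)
    {b₀ : ℕ} (hMb : OpBand (bdist β) b₀ M) {d : ℕ → ℕ → ℝ} (hd0 : ∀ i, d i i = 0)
    (hd : ∀ i j k, d i k ≤ d i j + d j k) (hMd : OpBand d b₀ M) :
    OpUpper β Ui ∧ ∀ ε > 0, ∃ b : ℕ, ∃ V : HS →L[ℝ] HS, OpUpper β V ∧ OpBand d b V ∧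
      OpBand (bdist β) b V ∧ ‖Ui - V‖ ≤ ε := by
  obtain ⟨α, hα, hB⟩ := contraction M c hc hell
  refine ⟨fun p q hpq => (key_column hL hLd hU hM hUi hα hB q).2 p hpq, ?_⟩
  set B := 1 - α • M with hBdef
  have hb0 : (0 : ℝ) ≤ b₀ := Nat.cast_nonneg _
  have hBband : ∀ d : ℕ → ℕ → ℝ, (∀ i, d i i = 0) → OpBand d b₀ M → OpBand d b₀ B := by
    intro d h0 h1
    rw [hBdef, sub_eq_add_neg, ← neg_smul]
    exact ((opBand_one h0).mono hb0).add (h1.smul _)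
  choose T hT1 hT2 hT3 using piece β B b₀ (hBband _ (bdist_self β) hMb)
  have hsum : Summable T := by
    refine Summable.of_norm_bounded (g := fun n : ℕ => (n * b₀ + 1) * ‖B‖ ^ n) ?_ hT1
    have s1 := (summable_pow_mul_geometric_of_norm_lt_one 1 (r := ‖B‖) (by simpa using hB)).mul_left
      (b₀ : ℝ)
    have s2 := summable_geometric_of_lt_one (norm_nonneg _) hB
    refine (s1.add s2).congr fun n => ?_
    ring
  have hlim : Ui = α • ∑' n, T n := by
    refine op_ext fun p q => ?_
    rw [(key_column hL hLd hU hM hUi hα hB q).1]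
    have hPB : ‖proj {p | β p ≤ β q} * B‖ < 1 := by
      refine (norm_mul_le _ _).trans_lt (lt_of_le_of_lt ?_ hB)
      exact mul_le_of_le_one_left (norm_nonneg _) (proj_norm _)
    let ev : (HS →L[ℝ] HS) →L[ℝ] ℝ := (coord p).comp (ContinuousLinearMap.apply ℝ HS (ee q))
    have hev : ∀ S, ev S = S (ee q) p := fun S => by
      simp only [ev, ContinuousLinearMap.comp_apply, ContinuousLinearMap.apply_apply, coord_apply]
    have t1 := (summable_geometric_of_norm_lt_one hPB).hasSum.mapL ev
    have t2 := hsum.hasSum.mapL ev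
    simp only [hev, hT2] at t1 t2
    have := t1.unique t2
    simp only [smul_apply, lp.coeFn_smul, Pi.smul_apply]
    rw [this]
  have htend := (hsum.hasSum.const_smul α).tendsto_sum_nat
  rw [← hlim] at htend
  intro ε hε
  obtain ⟨N, hN⟩ := (Metric.tendsto_atTop.1 htend) ε hε
  have hN := hN N le_rfl
  rw [dist_eq_norm, ← norm_neg, neg_sub] at hN
  have hbandV : ∀ d : ℕ → ℕ → ℝ, (∀ i, d i i = 0) → (∀ i j k, d i k ≤ d i j + d j k) →
      OpBand d b₀ M → OpBand d ((N * b₀ : ℕ) : ℝ) (∑ i ∈ Finset.range N, α • T i) := by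
    intro d h0 h1 h2 p q hpq
    rw [sum_apply, lp.coeFn_sum, Finset.sum_apply]
    refine Finset.sum_eq_zero fun n hn => ?_
    rw [smul_apply, lp.coeFn_smul, Pi.smul_apply, hT2]
    have := (OpBand.mul h1 (opBand_proj h0 {r | β r ≤ β q}) (hBband d h0 h2))
    rw [zero_add] at this
    rw [(this.pow h0 h1 n) p q, smul_zero]
    refine lt_of_le_of_lt ?_ hpq
    rw [Finset.mem_range] at hn
    exact_mod_cast Nat.mul_le_mul_right _ hn.le
  refine ⟨N * b₀, ∑ i ∈ Finset.range N, α • T i, ?_, hbandV d hd0 hd hMd,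
    hbandV _ (bdist_self β) (bdist_tri β) hMb, hN.le⟩
  intro p q hpq
  rw [sum_apply, lp.coeFn_sum, Finset.sum_apply]
  refine Finset.sum_eq_zero fun n hn => ?_
  rw [smul_apply, lp.coeFn_smul, Pi.smul_apply, hT3 n p q hpq, smul_zero]

/-- block diagonal part of an operator -/
noncomputable def pin (β : ℕ → ℕ) (A : HS →L[ℝ] HS) : HS →L[ℝ] HS :=
  (pinch_exists β (fun _ => A) ‖A‖ (norm_nonneg _) (fun _ => le_rfl) 0).choose

lemma pin_norm (β : ℕ → ℕ) (A : HS →L[ℝ] HS) : ‖pin β A‖ ≤ ‖A‖ :=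
  (pinch_exists β (fun _ => A) ‖A‖ (norm_nonneg _) (fun _ => le_rfl) 0).choose_spec.1

lemma pin_apply (β : ℕ → ℕ) (A : HS →L[ℝ] HS) (x : HS) (p : ℕ) :
    pin β A x p = A (proj {q | β q = β p} x) p :=
  (pinch_exists β (fun _ => A) ‖A‖ (norm_nonneg _) (fun _ => le_rfl) 0).choose_spec.2 x p

lemma pin_ent_eq {β : ℕ → ℕ} (A : HS →L[ℝ] HS) {p q : ℕ} (h : β q = β p) :
    pin β A (ee q) p = A (ee q) p := by
  rw [pin_apply, proj_ee, Set.indicator_of_mem (by exact h)]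

lemma pin_ent_ne {β : ℕ → ℕ} (A : HS →L[ℝ] HS) {p q : ℕ} (h : β q ≠ β p) :
    pin β A (ee q) p = 0 := by
  rw [pin_apply, proj_ee, Set.indicator_of_notMem (by exact h), map_zero]; rfl

lemma pin_sub (β : ℕ → ℕ) (A B : HS →L[ℝ] HS) : pin β (A - B) = pin β A - pin β B := by
  ext x p
  rw [pin_apply, sub_apply, sub_apply, lp.coeFn_sub, lp.coeFn_sub, Pi.sub_apply, Pi.sub_apply,
    pin_apply, pin_apply]

lemma pin_one (β : ℕ → ℕ) : pin β 1 = 1 := by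
  ext x p
  rw [pin_apply, one_apply_eq_self, one_apply_eq_self, proj_of_mem (by simp)]

lemma pin_mul {β : ℕ → ℕ} {A B : HS →L[ℝ] HS} (hA : OpUpper β A) (hB : OpUpper β B) :
    pin β (A * B) = pin β A * pin β B := by
  refine op_ext fun p q => ?_
  rw [mul_apply_eq_comp, pin_apply β A]
  by_cases h : β q = β p
  · rw [pin_ent_eq _ h, mul_apply_eq_comp, ← sub_eq_zero, ← Pi.sub_apply, ← lp.coeFn_sub,
      ← map_sub]
    refine op_zero fun r => ?_
    rcases lt_trichotomy (β r) (β p) with h1 | h1 | h1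
    · exact Or.inl (hA p r h1)
    · right
      rw [lp.coeFn_sub, Pi.sub_apply, proj_of_mem (by exact h1), pin_ent_eq _ (by omega), sub_self]
    · right
      rw [lp.coeFn_sub, Pi.sub_apply, hB r q (by omega), proj_of_notMem, sub_self]
      simp only [Set.mem_ofPred_eq]; omega
  · rw [pin_ent_ne _ h]
    have : proj {q | β q = β p} (pin β B (ee q)) = 0 := by
      ext r
      by_cases hr : β r = β p
      · rw [proj_of_mem (by exact hr), pin_ent_ne _ (by omega)]; rfl
      · rw [proj_of_notMem (by exact hr)]; rfl
    rw [this, map_zero]; rfl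

lemma D_elliptic {β : ℕ → ℕ} {M L U Ui : HS →L[ℝ] HS}
    (hL : ∀ p q, β p < β q → L (ee q) p = 0) (hLd : ∀ p q, β p = β q → L (ee q) p = ee q p)
    (hU : OpUpper β U) (hUiu : OpUpper β Ui)
    (hM : M = L * U) (hUi : Ui * U = 1) (hUi' : U * Ui = 1)
    {c : ℝ} (hc : 0 < c) (hell : ∀ x, c * ‖x‖ ^ 2 ≤ ⟪M x, x⟫_ℝ) (x : HS) :
    c * ‖x‖ ^ 2 ≤ ⟪pin β U x, x⟫_ℝ := by
  set z := pin β U x with hz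
  have hx : x = pin β Ui z := by
    rw [hz, ← mul_apply_eq_comp, ← pin_mul hUiu hU, hUi, pin_one]; rfl
  refine hasSum_le ?_ ((fiber_sq β x).mul_left c) (fiber_inner β z x)
  intro k
  set Q := proj {q | β q = k} with hQ
  set y := Ui (Q z) with hy
  have hQx : Q x = Q y := by
    ext p
    by_cases hp : β p = k
    · rw [hQ, proj_of_mem (by exact hp), proj_of_mem (by exact hp)]
      nth_rewrite 1 [hx]
      rw [pin_apply, hp]
    · rw [hQ, proj_of_notMem (by exact hp), proj_of_notMem (by exact hp)]
  have hMy : M y = L (Q z) := by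
    rw [hM, hy, ← mul_apply_eq_comp, mul_assoc, hUi', mul_one]
  have hysupp : ∀ p, k < β p → y p = 0 := by
    intro p hp
    refine hUiu.apply (k := k) ?_ hp
    intro r hr
    rw [hQ, proj_of_notMem]
    simp only [Set.mem_ofPred_eq]; omega
  have hin : ⟪M y, y⟫_ℝ = ⟪Q z, Q y⟫_ℝ := by
    have h1 := hs_inner (M y) y
    have h2 := hs_inner (Q z) (Q y)
    have e : (fun i => M y i * y i) = fun i => Q z i * Q y i := by
      funext p
      rcases lt_trichotomy (β p) k with h | h | h
      · have h3 : M y p = 0 := by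
          rw [hMy]
          refine op_zero fun r => ?_
          by_cases hr : β r = k
          · exact Or.inl (hL p r (by omega))
          · exact Or.inr (proj_of_notMem (by exact hr) _)
        have h4 : Q z p = 0 := by
          rw [hQ, proj_of_notMem]
          simp only [Set.mem_ofPred_eq]; omega
        rw [h3, h4, zero_mul, zero_mul]
      · have h3 : M y p = Q z p := by
          rw [hMy, ← sub_eq_zero]
          have : (L - 1) (Q z) p = 0 := by
            refine op_zero fun r => ?_
            by_cases hr : β r = k
            · left
              rw [sub_apply, lp.coeFn_sub, Pi.sub_apply, hLd p r (by omega), one_apply_eq_self,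
                sub_self]
            · exact Or.inr (proj_of_notMem (by exact hr) _)
          rwa [sub_apply, lp.coeFn_sub, Pi.sub_apply, one_apply_eq_self] at this
        rw [h3]
        congr 1
        rw [hQ, proj_of_mem (by exact h)]
      · have h4 : Q z p = 0 := by
          rw [hQ, proj_of_notMem]
          simp only [Set.mem_ofPred_eq]; omega
        rw [hysupp p h, h4, zero_mul, mul_zero]
    rw [e] at h1
    exact h1.unique h2
  rw [hQx, ← hin]
  refine le_trans ?_ (hell y)
  gcongr
  exact (Q.le_of_opNorm_le (proj_norm _) y).trans (by rw [one_mul])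

/-- block diagonal operators banded with respect to `d` -/
noncomputable def diagAlg (β : ℕ → ℕ) (d : ℕ → ℕ → ℝ) (hd0 : ∀ i, d i i = 0)
    (hd : ∀ i j k, d i k ≤ d i j + d j k) : Subalgebra ℝ (HS →L[ℝ] HS) where
  carrier := {T | OpBand (bdist β) 0 T ∧ ∃ b : ℕ, OpBand d b T}
  mul_mem' := by
    rintro S T ⟨h1, a, h2⟩ ⟨h3, b, h4⟩
    refine ⟨?_, a + b, ?_⟩
    · simpa using OpBand.mul (bdist_tri β) h1 h3
    · simpa using OpBand.mul hd h2 h4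
  add_mem' := by
    rintro S T ⟨h1, a, h2⟩ ⟨h3, b, h4⟩
    refine ⟨h1.add h3, max a b, ?_⟩
    exact (h2.mono (by exact_mod_cast le_max_left a b)).add
      (h4.mono (by exact_mod_cast le_max_right a b))
  algebraMap_mem' := by
    intro r
    rw [Algebra.algebraMap_eq_smul_one]
    refine ⟨(opBand_one (bdist_self β)).smul r, 0, ?_⟩
    simpa using (opBand_one hd0).smul r

lemma main_D {β : ℕ → ℕ} {M L U Ui : HS →L[ℝ] HS}
    (hL : ∀ p q, β p < β q → L (ee q) p = 0) (hLd : ∀ p q, β p = β q → L (ee q) p = ee q p)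
    (hU : OpUpper β U) (hM : M = L * U) (hUi : Ui * U = 1) (hUi' : U * Ui = 1)
    {c : ℝ} (hc : 0 < c) (hell : ∀ x, c * ‖x‖ ^ 2 ≤ ⟪M x, x⟫_ℝ)
    {d : ℕ → ℕ → ℝ} (hd0 : ∀ i, d i i = 0)
    (hd : ∀ i j k, d i k ≤ d i j + d j k) (hUiu : OpUpper β Ui)
    (happ : ∀ ε > 0, ∃ b : ℕ, ∃ V : HS →L[ℝ] HS, OpUpper β V ∧ OpBand d b V ∧
      OpBand (bdist β) b V ∧ ‖Ui - V‖ ≤ ε) :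
    ∀ ε > 0, ∃ b : ℕ, ∃ T : HS →L[ℝ] HS, OpBand (bdist β) 0 T ∧ OpBand d b T ∧
      ‖pin β U - T‖ ≤ ε := by
  have hDDi : pin β U * pin β Ui = 1 := by rw [← pin_mul hU hUiu, hUi', pin_one]
  have hell2 : ∀ z, c / (‖pin β U‖ + 1) ^ 2 * ‖z‖ ^ 2 ≤ ⟪pin β Ui z, z⟫_ℝ := by
    intro z
    have h1 := D_elliptic hL hLd hU hUiu hM hUi hUi' hc hell (pin β Ui z)
    rw [← mul_apply_eq_comp, hDDi, one_apply_eq_self, real_inner_comm] at h1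
    refine le_trans ?_ h1
    have h2 : ‖z‖ ≤ (‖pin β U‖ + 1) * ‖pin β Ui z‖ := by
      have : z = pin β U (pin β Ui z) := by
        rw [← mul_apply_eq_comp, hDDi, one_apply_eq_self]
      nth_rewrite 1 [this]
      exact (pin β U).le_of_opNorm_le (by linarith) _
    have h3 : ‖z‖ ^ 2 ≤ (‖pin β U‖ + 1) ^ 2 * ‖pin β Ui z‖ ^ 2 := by
      rw [← mul_pow]; gcongr
    rw [div_mul_eq_mul_div, div_le_iff₀ (by positivity)]
    calc c * ‖z‖ ^ 2 ≤ c * ((‖pin β U‖ + 1) ^ 2 * ‖pin β Ui z‖ ^ 2) := by gcongr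
      _ = _ := by ring
  obtain ⟨α, hα, hX⟩ := contraction (pin β Ui) _ (by positivity) hell2
  set X := 1 - α • pin β Ui with hXdef
  let A := diagAlg β d hd0 hd
  have hDi : pin β Ui ∈ A.topologicalClosure := by
    change pin β Ui ∈ closure (A : Set (HS →L[ℝ] HS))
    rw [Metric.mem_closure_iff]
    intro ε hε
    obtain ⟨b, V, -, hV2, -, hV4⟩ := happ (ε / 2) (by positivity)
    refine ⟨pin β V, ⟨?_, b, ?_⟩, ?_⟩
    · intro p q hpq
      apply pin_ent_ne
      intro h
      rw [bdist, h, sub_self, abs_zero] at hpq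
      exact lt_irrefl _ hpq
    · intro p q hpq
      by_cases h : β q = β p
      · rw [pin_ent_eq _ h, hV2 p q hpq]
      · exact pin_ent_ne _ h
    · rw [dist_eq_norm, ← pin_sub]
      have := pin_norm β (Ui - V)
      linarith
  have hXm : X ∈ A.topologicalClosure :=
    sub_mem (one_mem _) (Subalgebra.smul_mem _ hDi α)
  have hGm : (∑' n : ℕ, X ^ n) ∈ A.topologicalClosure := by
    refine A.isClosed_topologicalClosure.mem_of_tendsto
      (summable_geometric_of_norm_lt_one hX).hasSum.tendsto_sum_nat ?_
    exact Filter.Eventually.of_forall fun n => sum_mem fun i _ => pow_mem hXm i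
  have hD : pin β U = α • ∑' n : ℕ, X ^ n := by
    have hG := mul_neg_geom_series X hX
    have e : 1 - X = α • pin β Ui := by rw [hXdef, sub_sub_cancel]
    rw [e] at hG
    have := congrArg (fun T => pin β U * T) hG
    simp only [mul_one] at this
    rw [← this, ← mul_assoc, mul_smul_comm, hDDi, smul_mul_assoc, one_mul]
  have hDm : pin β U ∈ A.topologicalClosure := by
    rw [hD]; exact Subalgebra.smul_mem _ hGm α
  intro ε hε
  obtain ⟨T, ⟨hT1, b, hT2⟩, hT3⟩ := Metric.mem_closure_iff.1 hDm ε hε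
  refine ⟨b, T, hT1, hT2, ?_⟩
  rw [dist_eq_norm] at hT3
  exact hT3.le

lemma perturb_inv {U Ui V : HS →L[ℝ] HS} (hUi : Ui * U = 1) (hUi' : U * Ui = 1)
    (h : ‖U * (Ui - V)‖ ≤ 1 / 2) :
    ∃ W : HS →L[ℝ] HS, V * W = 1 ∧ W * V = 1 ∧ ‖W‖ ≤ 2 * ‖U‖ := by
  set X := U * (Ui - V) with hX
  have hX1 : ‖X‖ < 1 := by linarith
  have h1 := mul_neg_geom_series X hX1
  have h2 := geom_series_mul_neg X hX1
  set G := ∑' n : ℕ, X ^ n with hG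
  have hV : V = Ui * (1 - X) := by
    rw [hX, mul_sub, mul_one, ← mul_assoc, hUi, one_mul, sub_sub_cancel]
  refine ⟨G * U, ?_, ?_, ?_⟩
  · rw [hV, mul_assoc, ← mul_assoc (1 - X), h1, one_mul, hUi]
  · rw [hV, mul_assoc, ← mul_assoc U, hUi', one_mul, h2]
  · refine (norm_mul_le _ _).trans ?_
    gcongr
    have e : G = 1 + G * X := by
      rw [mul_sub, mul_one] at h2
      rw [← h2]; abel
    have n1 : ‖G‖ ≤ ‖(1 : HS →L[ℝ] HS)‖ + ‖G‖ * ‖X‖ := by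
      nth_rewrite 1 [e]
      exact (norm_add_le _ _).trans (by gcongr; exact norm_mul_le _ _)
    have n2 : ‖(1 : HS →L[ℝ] HS)‖ ≤ 1 := ContinuousLinearMap.norm_id_le
    have n3 : ‖G‖ * ‖X‖ ≤ ‖G‖ * (1 / 2) := by gcongr
    linarith

lemma block_fun {n : ℕ → ℕ} (hn : IsBlockStructure n) :
    ∃ β : ℕ → ℕ, ∀ i p, InBlock n i p ↔ β p = i := by
  obtain ⟨hm, h0⟩ := hn
  have ex : ∀ p, ∃ i, InBlock n i p := by
    intro p
    have hex : ∃ i, p < n i := ⟨p + 1, lt_of_lt_of_le (Nat.lt_succ_self p) (hm.id_le (p + 1))⟩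
    have hs := Nat.find_spec hex
    have hpos : Nat.find hex ≠ 0 := by
      intro h
      rw [h, h0] at hs
      omega
    obtain ⟨i, hi⟩ := Nat.exists_eq_succ_of_ne_zero hpos
    refine ⟨i, ?_, by rw [hi] at hs; exact hs⟩
    have := Nat.find_min hex (m := i) (by omega)
    omega
  choose β hβ using ex
  refine ⟨β, fun i p => ⟨fun h => ?_, fun h => h ▸ hβ p⟩⟩
  have h' := hβ p
  obtain ⟨a1, a2⟩ := h
  obtain ⟨b1, b2⟩ := h'
  have c1 : β p < i + 1 := hm.lt_iff_lt.1 (lt_of_le_of_lt b1 a2)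
  have c2 : i < β p + 1 := hm.lt_iff_lt.1 (lt_of_le_of_lt a1 b2)
  omega

/-- banded approximation `V` of `U⁻¹` (block-upper triangular,
banded w.r.t. the metric and block-banded, invertible with norms of `V`, `V⁻¹`
uniformly bounded in `ε`), and banded block-diagonal elliptic approximation `D_ε`
of the block diagonal `D` of `U`. -/
theorem banded_approximation_of_U_inverse
    (M : Mat) (hbdd : IsBoundedOp M)
    (Cell : ℝ) (hCell : 0 < Cell) (hell : Elliptic M Cell)
    (nseq : ℕ → ℕ) (hn : IsBlockStructure nseq)
    (b₀ : ℕ) (hbb : BlockBanded nseq b₀ M)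
    (d : ℕ → ℕ → ℝ) (hd : IsMetric d) (hband : Banded d (b₀ : ℝ) M)
    (L U : Mat)
    (hL : BlockLower nseq L) (hLd : UnitDiagBlocks nseq L) (hU : BlockUpper nseq U)
    (hLU : ∀ p q, M p q = ∑' r, L p r * U r q)
    (hLb : IsBoundedOp L) (hUb : IsBoundedOp U)
    (Linv Uinv : Mat)
    (hLinv : IsInverseOn L Linv) (hLinvb : IsBoundedOp Linv)
    (hUinv : IsInverseOn U Uinv) (hUinvb : IsBoundedOp Uinv) :
    ∃ ε₀ K : ℝ, 0 < ε₀ ∧ 0 < K ∧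
      ∀ ε : ℝ, 0 < ε → ε ≤ ε₀ →
        ∃ b : ℕ, ∃ V : Mat,
          BlockUpper nseq V ∧ Banded d (b : ℝ) V ∧ BlockBanded nseq b V ∧
          BoundedWith (matSub Uinv V) ε ∧
          (∃ Vinv : Mat, IsInverseOn V Vinv ∧
            ∃ s t : ℝ, 0 ≤ s ∧ 0 ≤ t ∧ s + t ≤ K ∧
              BoundedWith V s ∧ BoundedWith Vinv t) ∧
          ∃ Dε : Mat, BlockDiag nseq Dε ∧ Banded d (b : ℝ) Dε ∧
            IsBoundedOp Dε ∧ (∃ c : ℝ, 0 < c ∧ Elliptic Dε c) ∧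
            BoundedWith (matSub (blockDiagOf nseq U) Dε) ε := by

  obtain ⟨β, hβ⟩ := block_fun hn
  obtain ⟨hd1, hd2, hd3, hd4⟩ := hd
  have hd0 : ∀ i, d i i = 0 := fun i => (hd2 i i).2 rfl
  obtain ⟨KM, hKM, hMb⟩ := hbdd
  obtain ⟨KL, hKL, hLb⟩ := hLb
  obtain ⟨KU, hKU, hUb⟩ := hUb
  obtain ⟨KI, hKI, hIb⟩ := hUinvb
  obtain ⟨TM, -, -, hTM⟩ := op_of_bounded hKM hMb
  obtain ⟨TL, -, hTL', hTL⟩ := op_of_bounded hKL hLb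
  obtain ⟨TU, -, -, hTU⟩ := op_of_bounded hKU hUb
  obtain ⟨TI, -, -, hTI⟩ := op_of_bounded hKI hIb
  obtain ⟨hUI, hIU⟩ := op_of_inverse hTU hTI hUinv
  have oL : ∀ p q, β p < β q → TL (ee q) p = 0 := fun p q h => by
    rw [hTL]; exact hL _ _ p q ((hβ _ _).2 rfl) ((hβ _ _).2 rfl) h
  have oLd : ∀ p q, β p = β q → TL (ee q) p = ee q p := fun p q h => by
    rw [hTL, hLd (β p) p q ((hβ _ _).2 rfl) ((hβ _ _).2 h.symm), ee_apply]; rfl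
  have oU : OpUpper β TU := fun p q h => by
    rw [hTU]; exact hU _ _ p q ((hβ _ _).2 rfl) ((hβ _ _).2 rfl) h
  have oM : TM = TL * TU := by
    refine op_ext fun p q => ?_
    rw [mul_apply_eq_comp, hTM, hTL', hLU]
    simp only [mulVec, hTU]
  have oell := (elliptic_iff hTM).1 hell
  have oMb : OpBand (bdist β) b₀ TM := fun p q h => by
    rw [hTM]
    refine hbb _ _ p q ((hβ _ _).2 rfl) ((hβ _ _).2 rfl) ?_
    unfold bdist at h
    exact_mod_cast h
  have oMd : OpBand d b₀ TM := fun p q h => by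
    rw [hTM]; exact hband p q h
  obtain ⟨oI, hV⟩ := main_V oL oLd oU oM hIU hCell oell oMb hd0 hd4 oMd
  have hD := main_D oL oLd oU oM hIU hUI hCell oell hd0 hd4 oI hV
  have hDell := D_elliptic oL oLd oU oI oM hIU hUI hCell oell
  have nU := norm_nonneg TU
  refine ⟨min (Cell / 2) (1 / (2 * (‖TU‖ + 1))),
    ‖TI‖ + 1 / (2 * (‖TU‖ + 1)) + 2 * ‖TU‖, by positivity, by positivity, ?_⟩
  intro ε hε hε0
  have hε1 : ε ≤ Cell / 2 := hε0.trans (min_le_left _ _)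
  have hε2 : ε ≤ 1 / (2 * (‖TU‖ + 1)) := hε0.trans (min_le_right _ _)
  obtain ⟨b1, V, v1, v2, v3, v4⟩ := hV ε hε
  obtain ⟨b2, T, t1, t2, t3⟩ := hD ε hε
  have hl : (b1 : ℝ) ≤ (max b1 b2 : ℕ) := by exact_mod_cast le_max_left b1 b2
  have hr : (b2 : ℝ) ≤ (max b1 b2 : ℕ) := by exact_mod_cast le_max_right b1 b2
  have eβ : ∀ {i p}, InBlock nseq i p → β p = i := fun h => (hβ _ _).1 h
  refine ⟨max b1 b2, fun p q => V (ee q) p, ?_, v2.mono hl, ?_, ?_, ?_, fun p q => T (ee q) p,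
    ?_, t2.mono hr, ?_, ?_, ?_⟩
  · intro i j p q hi hj hij
    refine v1 p q ?_
    rw [eβ hi, eβ hj]; exact hij
  · intro i j p q hi hj hij
    refine v3.mono hl p q ?_
    unfold bdist
    rw [eβ hi, eβ hj]
    exact_mod_cast hij
  · refine bounded_of_op (T := TI - V) (fun p q => ?_) v4
    rw [sub_apply, lp.coeFn_sub, Pi.sub_apply, hTI]; rfl
  · have hX : ‖TU * (TI - V)‖ ≤ 1 / 2 := by
      refine (norm_mul_le _ _).trans ?_
      calc ‖TU‖ * ‖TI - V‖ ≤ (‖TU‖ + 1) * (1 / (2 * (‖TU‖ + 1))) := by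
            gcongr
            · linarith
            · linarith
        _ = 1 / 2 := by field_simp
    obtain ⟨W, w1, w2, w3⟩ := perturb_inv hIU hUI hX
    refine ⟨fun p q => W (ee q) p, inverse_of_op (fun _ _ => rfl) (fun _ _ => rfl) w1 w2,
      ‖TI‖ + 1 / (2 * (‖TU‖ + 1)), 2 * ‖TU‖, by positivity, by positivity, le_rfl,
      bounded_of_op (fun _ _ => rfl) ?_, bounded_of_op (fun _ _ => rfl) w3⟩
    have : V = TI - (TI - V) := by abel
    rw [this]
    refine (norm_sub_le _ _).trans ?_
    linarith
  · intro i j p q hi hj hij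
    refine t1 p q ?_
    unfold bdist
    rw [eβ hi, eβ hj, abs_pos, sub_ne_zero]
    exact_mod_cast hij
  · exact ⟨‖T‖, norm_nonneg _, bounded_of_op (fun _ _ => rfl) le_rfl⟩
  · refine ⟨Cell / 2, by positivity, (elliptic_iff (T := T) (fun _ _ => rfl)).2 fun x => ?_⟩
    have h1 := hDell x
    have h2 : ⟪(pin β TU - T) x, x⟫_ℝ ≤ Cell / 2 * ‖x‖ ^ 2 := by
      refine (real_inner_le_norm _ _).trans ?_
      rw [sq, ← mul_assoc]
      gcongr
      exact (pin β TU - T).le_of_opNorm_le (t3.trans hε1) x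
    rw [sub_apply, inner_sub_left] at h2
    linarith
  · refine bounded_of_op (T := pin β TU - T) (fun p q => ?_) t3
    rw [sub_apply, lp.coeFn_sub, Pi.sub_apply]
    unfold matSub blockDiagOf
    congr 1
    split_ifs with h
    · obtain ⟨i, h1, h2⟩ := h
      rw [pin_ent_eq _ (by rw [eβ h1, eβ h2]), hTU]
    · apply pin_ent_ne
      intro h'
      exact h ⟨β p, (hβ _ _).2 rfl, (hβ _ _).2 h'⟩
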